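/- arXiv:2504.01975 — 3 statements merged into one kernel-verified Lean document; each statement's English description precedes it below -/
import Mathlib

section
/- For every real number x > 0, the series Σ_{k=0}^∞ 1/(k+x)² equals Σ_{n=0}^∞ [(1)_n³ / ((1/2)_n · (x)_n²)] · (3n + 2x + 1) / (2(2n+1)(n+x)²) · (1/4)^n. -/
/-- The Pochhammer symbol (rising factorial): `poch a n = a (a+1) ⋯ (a+n-1)`. -/
noncomputable def poch (a : ℝ) (n : ℕ) : ℝ := (ascPochhammer ℝ n).eval a

open Filter Topology

lemma poch_zero (a : ℝ) : poch a 0 = 1 := by simp [poch]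

lemma poch_succ (a : ℝ) (n : ℕ) : poch a (n + 1) = poch a n * (a + n) := by
  simp [poch, ascPochhammer_succ_eval]

lemma poch_succ_left (a : ℝ) (n : ℕ) : poch a (n + 1) = a * poch (a + 1) n := by
  simp [poch, ascPochhammer_succ_left, Polynomial.eval_comp]

lemma poch_pos {a : ℝ} (ha : 0 < a) (n : ℕ) : 0 < poch a n :=
  ascPochhammer_pos n a ha

lemma poch_le_poch {a b : ℝ} (ha : 0 < a) (hab : a ≤ b) (n : ℕ) : poch a n ≤ poch b n := by
  induction n with
  | zero => simp [poch_zero]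
  | succ n ih =>
    rw [poch_succ, poch_succ]
    exact mul_le_mul ih (by linarith) (by positivity) (poch_pos (ha.trans_le hab) n).le

/-- The first member of the WZ pair: `n!⁴ / ((2n)! (y)_{n+1}²)`. -/
noncomputable def wzF (n : ℕ) (y : ℝ) : ℝ :=
  (poch 1 n) ^ 3 / (poch (1 / 2) n * (poch y n) ^ 2) / (y + n) ^ 2 * (1 / 4 : ℝ) ^ n

/-- The second member of the WZ pair, which is the summand of the accelerated series. -/
noncomputable def wzG (n : ℕ) (y : ℝ) : ℝ :=
  (poch 1 n) ^ 3 / (poch (1 / 2) n * (poch y n) ^ 2) *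
    ((3 * (n : ℝ) + 2 * y + 1) / (2 * (2 * (n : ℝ) + 1) * ((n : ℝ) + y) ^ 2)) *
    (1 / 4 : ℝ) ^ n

lemma wzF_zero (y : ℝ) : wzF 0 y = 1 / y ^ 2 := by simp [wzF, poch_zero]

lemma wzF_nonneg (n : ℕ) {y : ℝ} (hy : 0 < y) : 0 ≤ wzF n y := by
  have := poch_pos (a := 1) one_pos n
  have := poch_pos (a := 1 / 2) (by norm_num) n
  unfold wzF
  positivity

lemma wzG_eq (n : ℕ) {y : ℝ} (hy : 0 < y) :
    wzG n y = wzF n y * ((3 * (n : ℝ) + 2 * y + 1) / (2 * (2 * (n : ℝ) + 1))) := by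
  have := poch_pos (a := 1 / 2) (by norm_num) n
  have := poch_pos hy n
  have : 0 < y + n := by positivity
  unfold wzF wzG
  rw [add_comm (n : ℝ) y]
  field_simp

lemma wzG_nonneg (n : ℕ) {y : ℝ} (hy : 0 < y) : 0 ≤ wzG n y := by
  rw [wzG_eq n hy]
  have := wzF_nonneg n hy
  positivity

lemma wzF_sub_wzF_succ (n : ℕ) {y : ℝ} (hy : 0 < y) :
    wzF n y - wzF (n + 1) y = wzG n y - wzG n (y + 1) := by
  have h2 := poch_pos (a := 1 / 2) (by norm_num) n
  have hp := poch_pos hy n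
  have hn : 0 < y + n := by positivity
  have hn1 : 0 < y + n + 1 := by positivity
  have hq : poch (y + 1) n = poch y n * (y + n) / y := by
    rw [eq_div_iff hy.ne', mul_comm, ← poch_succ_left, poch_succ]
  unfold wzF wzG
  rw [hq, poch_succ, poch_succ, poch_succ, pow_succ (1 / 4 : ℝ) n]
  have e1 : (1 / 2 + n : ℝ) = (2 * n + 1) / 2 := by ring
  have e2 : (n : ℝ) + (y + 1) = y + n + 1 := by ring
  have e3 : y + ((n + 1 : ℕ) : ℝ) = y + n + 1 := by push_cast; ring
  rw [e1, e2, e3, add_comm (n : ℝ) y]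
  generalize poch 1 n = a at *
  generalize poch (1 / 2) n = b at *
  generalize poch y n = c at *
  field_simp
  ring

lemma poch_one_mul_le (n : ℕ) :
    poch 1 n * (1 / 4 : ℝ) ^ n / poch (1 / 2) n ≤ 1 / ((n : ℝ) + 1) := by
  induction n with
  | zero => simp [poch_zero]
  | succ n ih =>
    have h2 := poch_pos (a := 1 / 2) (by norm_num) n
    have e : poch 1 (n + 1) * (1 / 4 : ℝ) ^ (n + 1) / poch (1 / 2) (n + 1) =
        poch 1 n * (1 / 4 : ℝ) ^ n / poch (1 / 2) n * (((n : ℝ) + 1) / (4 * n + 2)) := by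
      rw [poch_succ, poch_succ, pow_succ, show (1 / 2 + n : ℝ) = (4 * n + 2) / 4 by ring]
      field_simp
      ring
    rw [e]
    calc _ ≤ 1 / ((n : ℝ) + 1) * (((n : ℝ) + 1) / (4 * n + 2)) := by gcongr
      _ = 1 / (4 * (n : ℝ) + 2) := by field_simp
      _ ≤ _ := by
        push_cast
        exact one_div_le_one_div_of_le (by positivity) (by linarith [n.cast_nonneg (α := ℝ)])

lemma wzF_le (n : ℕ) {y : ℝ} (hy : 0 < y) : wzF n y ≤ 1 / ((n : ℝ) + 1) * (1 / y ^ 2) := by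
  have h1 := poch_pos (a := 1) one_pos n
  have h2 := poch_pos (a := 1 / 2) (by norm_num) n
  have hp := poch_pos hy n
  have hq : y * poch 1 n ≤ poch y n * (y + n) := by
    rw [← poch_succ, poch_succ_left]
    exact mul_le_mul_of_nonneg_left (poch_le_poch one_pos (by linarith) n) hy.le
  have e : wzF n y = poch 1 n * (1 / 4 : ℝ) ^ n / poch (1 / 2) n *
      (poch 1 n ^ 2 / (poch y n * (y + n)) ^ 2) := by
    unfold wzF
    field_simp
  rw [e]
  refine mul_le_mul (poch_one_mul_le n) ?_ (by positivity) (by positivity)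
  rw [div_le_div_iff₀ (by positivity) (by positivity), one_mul, ← mul_pow, mul_comm]
  gcongr

lemma wzF_le_one_div_sq (n : ℕ) {y : ℝ} (hy : 0 < y) : wzF n y ≤ 1 / y ^ 2 := by
  refine (wzF_le n hy).trans (mul_le_of_le_one_left (by positivity) ?_)
  rw [div_le_one (by positivity)]
  linarith [n.cast_nonneg (α := ℝ)]

lemma summable_one_div_add_sq (x : ℝ) :
    Summable fun k : ℕ => 1 / ((k : ℝ) + x) ^ 2 := by
  refine ((Real.summable_one_div_nat_add_rpow x 2).2 one_lt_two).congr fun k => ?_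
  rw [Real.rpow_two, sq_abs]

lemma summable_wzF (n : ℕ) {x : ℝ} (hx : 0 < x) : Summable fun k : ℕ => wzF n (k + x) :=
  (summable_one_div_add_sq x).of_nonneg_of_le (fun _ => wzF_nonneg n (by positivity))
    fun _ => wzF_le_one_div_sq n (by positivity)

lemma tendsto_wzG (n : ℕ) : Tendsto (wzG n) atTop (𝓝 0) := by
  have hlim : Tendsto (fun y : ℝ => (3 * (n : ℝ) + 1) * (y⁻¹ * y⁻¹) + 2 * y⁻¹) atTop (𝓝 0) := by
    have h := tendsto_inv_atTop_zero (𝕜 := ℝ)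
    simpa using ((h.mul h).const_mul (3 * (n : ℝ) + 1)).add (h.const_mul 2)
  refine tendsto_of_tendsto_of_tendsto_of_le_of_le' tendsto_const_nhds hlim ?_ ?_
  · filter_upwards [eventually_gt_atTop 0] with y hy using wzG_nonneg n hy
  · filter_upwards [eventually_gt_atTop 0] with y hy
    rw [wzG_eq n hy]
    calc _ ≤ 1 / y ^ 2 * (3 * (n : ℝ) + 2 * y + 1) := by
          refine mul_le_mul (wzF_le_one_div_sq n hy) ?_ (by positivity) (by positivity)
          refine div_le_self (by positivity) ?_
          linarith [n.cast_nonneg (α := ℝ)]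
      _ = _ := by field_simp; ring

lemma tsum_wzF_sub_tsum_wzF_succ (n : ℕ) {x : ℝ} (hx : 0 < x) :
    ∑' k : ℕ, wzF n (k + x) - ∑' k : ℕ, wzF (n + 1) (k + x) = wzG n x := by
  have h := ((summable_wzF n hx).hasSum.sub (summable_wzF (n + 1) hx).hasSum).tendsto_sum_nat
  refine tendsto_nhds_unique h ?_
  have hsum (N : ℕ) : ∑ k ∈ Finset.range N, (wzF n (k + x) - wzF (n + 1) (k + x)) =
      wzG n x - wzG n (N + x) := by
    have := Finset.sum_range_sub' (fun k : ℕ => wzG n (k + x)) N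
    simp only [Nat.cast_zero, zero_add] at this
    rw [← this]
    refine Finset.sum_congr rfl fun k _ => ?_
    rw [wzF_sub_wzF_succ n (by positivity)]
    push_cast
    rw [add_right_comm]
  simp only [hsum]
  simpa using ((tendsto_wzG n).comp
    (tendsto_atTop_add_const_right _ x tendsto_natCast_atTop_atTop)).const_sub (wzG n x)

lemma tendsto_tsum_wzF {x : ℝ} (hx : 0 < x) :
    Tendsto (fun n : ℕ => ∑' k : ℕ, wzF n (k + x)) atTop (𝓝 0) := by
  refine squeeze_zero (fun n => tsum_nonneg fun k => wzF_nonneg n (by positivity))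
    (g := fun n : ℕ => 1 / ((n : ℝ) + 1) * ∑' k : ℕ, 1 / ((k : ℝ) + x) ^ 2) (fun n => ?_) ?_
  · rw [← tsum_mul_left]
    exact (summable_wzF n hx).tsum_le_tsum (fun k => wzF_le n (by positivity))
      ((summable_one_div_add_sq x).mul_left _)
  · simpa only [zero_mul] using
      (tendsto_one_div_add_atTop_nhds_zero_nat (𝕜 := ℝ)).mul_const _

lemma hasSum_wzG {x : ℝ} (hx : 0 < x) :
    HasSum (fun n : ℕ => wzG n x) (∑' k : ℕ, 1 / ((k : ℝ) + x) ^ 2) := by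
  rw [hasSum_iff_tendsto_nat_of_nonneg fun n => wzG_nonneg n hx]
  simp only [← tsum_wzF_sub_tsum_wzF_succ _ hx,
    Finset.sum_range_sub' (fun n : ℕ => ∑' k : ℕ, wzF n (k + x)), wzF_zero]
  simpa only [sub_zero] using (tendsto_tsum_wzF hx).const_sub (∑' k : ℕ, 1 / ((k : ℝ) + x) ^ 2)

theorem zeta2_fast_formula (x : ℝ) (hx : 0 < x) :
    ∑' k : ℕ, 1 / ((k : ℝ) + x) ^ 2 =
      ∑' n : ℕ, (poch 1 n) ^ 3 / (poch (1 / 2) n * (poch x n) ^ 2) *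
        ((3 * (n : ℝ) + 2 * x + 1) / (2 * (2 * (n : ℝ) + 1) * ((n : ℝ) + x) ^ 2)) *
        (1 / 4 : ℝ) ^ n :=
  (hasSum_wzG hx).tsum_eq.symm
end

section
/- π²/6 = Σ_{N=0}^∞ (13/8) · Π_{n=0}^{N−1} [(n+1)³(21n+34)] / [8(2n+3)³(21n+13)], where the empty product (N = 0) equals 1. -/
open Real

/-- The first member of the Wilf–Zeilberger pair that accelerates `∑ 1 / (k + 1) ^ 2`. -/
noncomputable def wzTerm (n k : ℕ) : ℝ :=
  (n.factorial : ℝ) ^ 4 * ((n + k).factorial : ℝ) ^ 2 /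
    (((2 * n).factorial : ℝ) * ((2 * n + k + 1).factorial : ℝ) ^ 2)

/-- The second member of the Wilf–Zeilberger pair. -/
noncomputable def wzMate (n k : ℕ) : ℝ :=
  wzTerm n k *
    (2 * (k : ℝ) ^ 3 + (13 * n + 11) * (k : ℝ) ^ 2 + (n + 1) * (28 * n + 20) * k +
      (n + 1) ^ 2 * (21 * n + 13)) /
    (2 * (2 * n + 1) * (2 * n + k + 2) ^ 2)

lemma wzTerm_nonneg (n k : ℕ) : 0 ≤ wzTerm n k := by
  unfold wzTerm
  positivity

lemma wzMate_nonneg (n k : ℕ) : 0 ≤ wzMate n k := by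
  have := wzTerm_nonneg n k
  unfold wzMate
  positivity

lemma wzTerm_zero_left (k : ℕ) : wzTerm 0 k = 1 / ((k : ℝ) + 1) ^ 2 := by
  simp only [wzTerm, Nat.factorial_zero, mul_zero, zero_add, Nat.factorial_succ]
  push_cast
  field_simp

lemma wzTerm_succ_left (n k : ℕ) :
    wzTerm (n + 1) k = wzTerm n k *
      ((n + 1) ^ 3 * (n + k + 1) ^ 2 /
        (2 * (2 * n + 1) * (2 * n + k + 2) ^ 2 * (2 * n + k + 3) ^ 2)) := by
  have h₁ : n + 1 + k = (n + k) + 1 := by ring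
  have h₂ : 2 * (n + 1) = 2 * n + 1 + 1 := by ring
  have h₃ : 2 * n + 1 + 1 + k + 1 = (2 * n + k + 1) + 1 + 1 := by ring
  simp only [wzTerm, h₁, h₂, h₃, Nat.factorial_succ (n + k), Nat.factorial_succ n,
    Nat.factorial_succ (2 * n), Nat.factorial_succ (2 * n + 1),
    Nat.factorial_succ (2 * n + k + 1), Nat.factorial_succ (2 * n + k + 1 + 1)]
  push_cast
  field_simp
  ring

lemma wzTerm_succ_right (n k : ℕ) :
    wzTerm n (k + 1) = wzTerm n k * ((n + k + 1) ^ 2 / (2 * n + k + 2) ^ 2) := by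
  simp only [wzTerm, ← add_assoc, Nat.factorial_succ (n + k),
    Nat.factorial_succ (2 * n + k + 1)]
  push_cast
  field_simp
  ring

lemma wzTerm_sub_succ_left (n k : ℕ) :
    wzTerm n k - wzTerm (n + 1) k = wzMate n k - wzMate n (k + 1) := by
  rw [wzMate, wzMate, wzTerm_succ_left, wzTerm_succ_right]
  push_cast
  field_simp
  ring

lemma wzTerm_le (n k : ℕ) : wzTerm n k ≤ (1 / 8) ^ n * (1 / ((k : ℝ) + 1) ^ 2) := by
  induction n with
  | zero => simp [wzTerm_zero_left]
  | succ n ih =>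
    have hratio : ((n : ℝ) + 1) ^ 3 * (n + k + 1) ^ 2 /
        (2 * (2 * n + 1) * (2 * n + k + 2) ^ 2 * (2 * n + k + 3) ^ 2) ≤ 1 / 8 := by
      calc ((n : ℝ) + 1) ^ 3 * (n + k + 1) ^ 2 /
            (2 * (2 * n + 1) * (2 * n + k + 2) ^ 2 * (2 * n + k + 3) ^ 2)
          ≤ ((n : ℝ) + 1) ^ 3 * (n + k + 1) ^ 2 /
            (2 * (n + 1) * (2 * n + 2) ^ 2 * (n + k + 1) ^ 2) := by
            gcongr <;> linarith [(n.cast_nonneg : (0 : ℝ) ≤ n), (k.cast_nonneg : (0 : ℝ) ≤ k)]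
        _ = 1 / 8 := by field_simp; ring
    calc wzTerm (n + 1) k ≤ wzTerm n k * (1 / 8) := by
          rw [wzTerm_succ_left]
          exact mul_le_mul_of_nonneg_left hratio (wzTerm_nonneg n k)
      _ ≤ (1 / 8) ^ n * (1 / ((k : ℝ) + 1) ^ 2) * (1 / 8) := by gcongr
      _ = (1 / 8) ^ (n + 1) * (1 / ((k : ℝ) + 1) ^ 2) := by ring

lemma hasSum_one_div_add_one_sq :
    HasSum (fun k : ℕ => 1 / ((k : ℝ) + 1) ^ 2) (π ^ 2 / 6) := by
  simpa using (hasSum_nat_add_iff' 1).mpr hasSum_zeta_two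

lemma summable_wzTerm (n : ℕ) : Summable (wzTerm n) :=
  Summable.of_nonneg_of_le (wzTerm_nonneg n) (wzTerm_le n)
    (hasSum_one_div_add_one_sq.summable.mul_left _)

lemma wzMate_le (n k : ℕ) : wzMate n k ≤ 21 * (n + 1) * (1 / ((k : ℝ) + 1)) := by
  have hpoly : 2 * (k : ℝ) ^ 3 + (13 * n + 11) * (k : ℝ) ^ 2 + (n + 1) * (28 * n + 20) * k +
      (n + 1) ^ 2 * (21 * n + 13) ≤ 21 * ((n : ℝ) + k + 1) ^ 3 := by
    rw [← sub_nonneg]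
    ring_nf
    positivity
  have hterm : wzTerm n k ≤ 1 / ((k : ℝ) + 1) ^ 2 :=
    (wzTerm_le n k).trans (mul_le_of_le_one_left (by positivity)
      (pow_le_one₀ (by norm_num) (by norm_num)))
  have hn : (0 : ℝ) ≤ n := n.cast_nonneg
  have hk : (0 : ℝ) ≤ k := k.cast_nonneg
  calc wzMate n k
      ≤ 1 / ((k : ℝ) + 1) ^ 2 * (21 * ((n : ℝ) + k + 1) ^ 3) / (1 * (n + k + 1) ^ 2) := by
        unfold wzMate
        gcongr <;> linarith
    _ = 21 * ((n : ℝ) + k + 1) / (k + 1) ^ 2 := by field_simp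
    _ ≤ 21 * (((n : ℝ) + 1) * (k + 1)) / (k + 1) ^ 2 := by
        gcongr
        nlinarith [mul_nonneg hn hk]
    _ = 21 * (n + 1) * (1 / ((k : ℝ) + 1)) := by field_simp

lemma tendsto_wzMate (n : ℕ) : Filter.Tendsto (wzMate n) Filter.atTop (nhds 0) :=
  squeeze_zero (wzMate_nonneg n) (wzMate_le n) (by
    simpa using tendsto_one_div_add_atTop_nhds_zero_nat.const_mul (21 * ((n : ℝ) + 1)))

lemma tsum_wzTerm_sub_succ (n : ℕ) :
    ∑' k, wzTerm n k - ∑' k, wzTerm (n + 1) k = wzMate n 0 := by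
  have hsum := ((summable_wzTerm n).hasSum.sub (summable_wzTerm (n + 1)).hasSum).tendsto_sum_nat
  simp only [wzTerm_sub_succ_left, Finset.sum_range_sub'] at hsum
  have hlim := (tendsto_wzMate n).const_sub (wzMate n 0)
  rw [sub_zero] at hlim
  exact tendsto_nhds_unique hsum hlim

lemma tsum_wzTerm_zero : ∑' k, wzTerm 0 k = π ^ 2 / 6 := by
  simp only [wzTerm_zero_left]
  exact hasSum_one_div_add_one_sq.tsum_eq

lemma tendsto_tsum_wzTerm :
    Filter.Tendsto (fun n => ∑' k, wzTerm n k) Filter.atTop (nhds 0) := by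
  have hgeom := (tendsto_pow_atTop_nhds_zero_of_lt_one (r := (1 / 8 : ℝ)) (by norm_num)
    (by norm_num)).mul_const (π ^ 2 / 6)
  rw [zero_mul] at hgeom
  exact squeeze_zero (fun n => tsum_nonneg (wzTerm_nonneg n))
    (fun n => hasSum_le (wzTerm_le n) (summable_wzTerm n).hasSum
      (hasSum_one_div_add_one_sq.mul_left _)) hgeom

lemma hasSum_wzMate_zero : HasSum (fun n => wzMate n 0) (π ^ 2 / 6) := by
  rw [hasSum_iff_tendsto_nat_of_nonneg (fun n => wzMate_nonneg n 0)]
  simp only [← tsum_wzTerm_sub_succ, Finset.sum_range_sub' (fun n => ∑' k, wzTerm n k),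
    tsum_wzTerm_zero]
  simpa using tendsto_tsum_wzTerm.const_sub (π ^ 2 / 6)

lemma wzMate_zero_right_eq_prod (N : ℕ) :
    wzMate N 0 = (13 / 8 : ℝ) *
      ∏ n ∈ Finset.range N,
        (((n : ℝ) + 1) ^ 3 * (21 * (n : ℝ) + 34)) /
          (8 * (2 * (n : ℝ) + 3) ^ 3 * (21 * (n : ℝ) + 13)) := by
  induction N with
  | zero => norm_num [wzMate, wzTerm]
  | succ N ih =>
    rw [Finset.prod_range_succ, ← mul_assoc, ← ih, wzMate, wzMate, wzTerm_succ_left]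
    push_cast
    field_simp
    ring

theorem pi_sq_div_six_partial_products :
    π ^ 2 / 6 =
      ∑' N : ℕ, (13 / 8 : ℝ) *
        ∏ n ∈ Finset.range N,
          (((n : ℝ) + 1) ^ 3 * (21 * (n : ℝ) + 34)) /
            (8 * (2 * (n : ℝ) + 3) ^ 3 * (21 * (n : ℝ) + 13)) := by
  simp only [← wzMate_zero_right_eq_prod]
  exact hasSum_wzMate_zero.tsum_eq.symm
end

section
/- Let χ₅ : ℕ → ℤ be defined by χ₅(n) = 1 if n ≡ 1 or 4 (mod 5), χ₅(n) = −1 if n ≡ 2 or 3 (mod 5), and χ₅(n) = 0 if 5 divides n. Then 625 · Σ_{n=1}^∞ χ₅(n)/n³ = −4π³·√(25 − 2√5) + 10 · Σ_{k=0}^∞ 1/(k + 1/5)³ − 10 · Σ_{k=0}^∞ 1/(k + 2/5)³. -/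
open Real

/-- The primitive quadratic Dirichlet character modulo 5 (Legendre symbol mod 5). -/
def chi5 (n : ℕ) : ℤ :=
  if n % 5 = 1 ∨ n % 5 = 4 then 1 else if n % 5 = 2 ∨ n % 5 = 3 then -1 else 0

/-- Splitting a `5`-periodic Dirichlet series at `3` into Hurwitz zeta values. -/
theorem tsum_periodic_five_div_cube {c : ℕ → ℝ} (hper : ∀ r m, c (r + 5 * m) = c r)
    (h0 : c 0 = 0) (hs : Summable fun n : ℕ => c n / (n : ℝ) ^ 3) :
    125 * ∑' n : ℕ, c n / (n : ℝ) ^ 3 =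
      c 1 * (∑' k : ℕ, 1 / ((k : ℝ) + 1 / 5) ^ 3) + c 2 * (∑' k : ℕ, 1 / ((k : ℝ) + 2 / 5) ^ 3) +
      c 3 * (∑' k : ℕ, 1 / ((k : ℝ) + 3 / 5) ^ 3) +
      c 4 * ∑' k : ℕ, 1 / ((k : ℝ) + 4 / 5) ^ 3 := by
  have key : ∀ j : ℕ, 0 < j → 125 * ∑' m : ℕ, c (j + 5 * m) / ((j + 5 * m : ℕ) : ℝ) ^ 3 =
      c j * ∑' k : ℕ, 1 / ((k : ℝ) + j / 5) ^ 3 := by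
    intro j hj
    rw [← tsum_mul_left, ← tsum_mul_left]
    congr 1 with m
    have hj' : (0 : ℝ) < j := by exact_mod_cast hj
    have h1 : (j : ℝ) + 5 * m ≠ 0 := by positivity
    have h2 : (m : ℝ) + j / 5 = (j + 5 * m) / 5 := by ring
    rw [hper, h2]
    push_cast
    field_simp
    ring
  have hz : ∑' m : ℕ, c (0 + 5 * m) / ((0 + 5 * m : ℕ) : ℝ) ^ 3 = 0 := by
    simp only [hper, h0, zero_div, tsum_zero]
  have k1 := key 1 (by norm_num)
  have k2 := key 2 (by norm_num)
  have k3 := key 3 (by norm_num)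
  have k4 := key 4 (by norm_num)
  simp only [Nat.cast_one, Nat.cast_ofNat] at k1 k2 k3 k4
  have hsum : ∑' n : ℕ, c n / (n : ℝ) ^ 3 =
      ∑ j : Fin 5, ∑' m : ℕ, c (j.val + 5 * m) / ((j.val + 5 * m : ℕ) : ℝ) ^ 3 :=
    Nat.sumByResidueClasses hs 5
  rw [hsum]
  rw [Fin.sum_univ_five, ← k1, ← k2, ← k3, ← k4]
  change 125 * (∑' m : ℕ, c (0 + 5 * m) / ((0 + 5 * m : ℕ) : ℝ) ^ 3 +
    ∑' m : ℕ, c (1 + 5 * m) / ((1 + 5 * m : ℕ) : ℝ) ^ 3 +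
    ∑' m : ℕ, c (2 + 5 * m) / ((2 + 5 * m : ℕ) : ℝ) ^ 3 +
    ∑' m : ℕ, c (3 + 5 * m) / ((3 + 5 * m : ℕ) : ℝ) ^ 3 +
    ∑' m : ℕ, c (4 + 5 * m) / ((4 + 5 * m : ℕ) : ℝ) ^ 3) = _
  rw [hz]
  ring

theorem hasSum_sin_div_cube {x : ℝ} (hx : x ∈ Set.Icc (0 : ℝ) 1) :
    HasSum (fun n : ℕ => Real.sin (2 * π * n * x) / (n : ℝ) ^ 3)
      (2 * π ^ 3 / 3 * (x ^ 3 - 3 / 2 * x ^ 2 + x / 2)) := by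
  have h := hasSum_one_div_nat_pow_mul_sin one_ne_zero hx
  convert h using 1
  · ext n
    norm_num
    ring
  · have hB : (Polynomial.map (algebraMap ℚ ℝ) (Polynomial.bernoulli 3)).eval x =
        x ^ 3 - 3 / 2 * x ^ 2 + x / 2 := by
      simp [Polynomial.bernoulli, Finset.sum_range_succ, bernoulli_eq_bernoulli'_of_ne_one,
        bernoulli_one, Nat.choose, Polynomial.eval_add, Polynomial.eval_monomial]
      ring
    rw [show 2 * 1 + 1 = 3 from rfl, hB]
    norm_num [Nat.factorial]
    left
    ring

theorem sin_two_pi_div_five_mul_periodic (j r m : ℕ) :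
    Real.sin (2 * π * (r + 5 * m : ℕ) * (j / 5)) = Real.sin (2 * π * r * (j / 5)) := by
  rw [← Real.sin_add_nat_mul_two_pi (2 * π * r * (j / 5)) (m * j)]
  congr 1
  push_cast
  ring

theorem L_5_three_hurwitz :
    625 * ∑' n : ℕ, (chi5 (n + 1) : ℝ) / ((n : ℝ) + 1) ^ 3 =
      -4 * π ^ 3 * Real.sqrt (25 - 2 * Real.sqrt 5) +
        10 * (∑' k : ℕ, 1 / ((k : ℝ) + 1 / 5) ^ 3) -
        10 * ∑' k : ℕ, 1 / ((k : ℝ) + 2 / 5) ^ 3 := by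
  have hchi : Summable fun n : ℕ => (chi5 n : ℝ) / (n : ℝ) ^ 3 := by
    refine Summable.of_norm_bounded (Real.summable_one_div_nat_pow.mpr (by norm_num : 1 < 3)) ?_
    intro n
    rw [norm_div, norm_pow, Real.norm_natCast]
    gcongr
    unfold chi5
    split_ifs <;> simp
  have hL := tsum_periodic_five_div_cube (c := fun n => (chi5 n : ℝ))
    (fun r m => by simp [chi5]) (by simp [chi5]) hchi
  rw [hchi.tsum_eq_zero_add] at hL
  have hS1 := hasSum_sin_div_cube (x := (1 : ℕ) / 5) (by norm_num)
  have hS2 := hasSum_sin_div_cube (x := (2 : ℕ) / 5) (by norm_num)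
  have e1 := tsum_periodic_five_div_cube (sin_two_pi_div_five_mul_periodic 1) (by simp) hS1.summable
  have e2 := tsum_periodic_five_div_cube (sin_two_pi_div_five_mul_periodic 2) (by simp) hS2.summable
  rw [hS1.tsum_eq] at e1
  rw [hS2.tsum_eq] at e2
  generalize (∑' k : ℕ, 1 / ((k : ℝ) + 1 / 5) ^ 3) = A₁ at *
  generalize (∑' k : ℕ, 1 / ((k : ℝ) + 2 / 5) ^ 3) = A₂ at *
  generalize (∑' k : ℕ, 1 / ((k : ℝ) + 3 / 5) ^ 3) = A₃ at *
  generalize (∑' k : ℕ, 1 / ((k : ℝ) + 4 / 5) ^ 3) = A₄ at *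
  simp only [Nat.cast_one, Nat.cast_ofNat] at e1 e2
  set s := Real.sin (π / 5) with hs
  set c := Real.cos (π / 5) with hc
  have hsin2 : Real.sin (2 * (π / 5)) = 2 * s * c := Real.sin_two_mul _
  have a11 : Real.sin (2 * π * 1 * (1 / 5)) = 2 * s * c := by
    rw [← hsin2]; ring_nf
  have a12 : Real.sin (2 * π * 2 * (1 / 5)) = s := by
    rw [hs, ← Real.sin_pi_sub]; ring_nf
  have a13 : Real.sin (2 * π * 3 * (1 / 5)) = -s := by
    rw [hs, ← Real.sin_add_pi]; ring_nf
  have a14 : Real.sin (2 * π * 4 * (1 / 5)) = -(2 * s * c) := by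
    rw [← hsin2, ← Real.sin_two_pi_sub]; ring_nf
  have a21 : Real.sin (2 * π * 1 * (2 / 5)) = s := by
    rw [← a12]; ring_nf
  have a22 : Real.sin (2 * π * 2 * (2 / 5)) = -(2 * s * c) := by
    rw [← a14]; ring_nf
  have a23 : Real.sin (2 * π * 3 * (2 / 5)) = 2 * s * c := by
    rw [← hsin2, ← Real.sin_add_two_pi (2 * (π / 5))]; ring_nf
  have a24 : Real.sin (2 * π * 4 * (2 / 5)) = -s := by
    rw [← a13, ← Real.sin_add_two_pi (2 * π * 3 * (1 / 5))]; ring_nf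
  rw [a11, a12, a13, a14] at e1
  rw [a21, a22, a23, a24] at e2
  have hcval : c = (1 + √5) / 4 := Real.cos_pi_div_five
  have h5 : √5 ^ 2 = 5 := Real.sq_sqrt (by norm_num)
  have hs2 : s ^ 2 = (5 - √5) / 8 := by
    have := Real.sin_sq_add_cos_sq (π / 5)
    rw [← hs, ← hc, hcval] at this
    linear_combination this - h5 / 16
  have hspos : 0 < s := Real.sin_pos_of_pos_of_lt_pi (by positivity) (by linarith [Real.pi_pos])
  have hroot : √(25 - 2 * √5) = 12 * s * c - 2 * s := by
    have hR : 12 * s * c - 2 * s = s * (1 + 3 * √5) := by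
      rw [hcval]
      ring
    rw [hR, ← Real.sqrt_sq (by positivity : 0 ≤ s * (1 + 3 * √5))]
    congr 1
    rw [mul_pow, hs2]
    linear_combination (-39 / 8 + 9 / 8 * √5) * h5
  have hchi1 : chi5 1 = 1 := rfl
  have hchi2 : chi5 2 = -1 := rfl
  have hchi3 : chi5 3 = -1 := rfl
  have hchi4 : chi5 4 = 1 := rfl
  simp only [hchi1, hchi2, hchi3, hchi4] at hL
  push_cast at hL
  have hnorm : (2 * s * c) ^ 2 + s ^ 2 = 5 / 4 := by
    have hc2 : c ^ 2 = (3 + √5) / 8 := by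
      rw [hcval]
      linear_combination h5 / 16
    linear_combination (4 * c ^ 2 + 1) * hs2 + (5 - √5) / 2 * hc2 - h5 / 16
  have hchi0 : chi5 0 = 0 := rfl
  rw [hroot]
  simp only [hchi0, Int.cast_zero, zero_div, zero_add] at hL
  linear_combination 5 * hL + 4 * (2 * s * c - s) * e1 + 4 * (s + 2 * s * c) * e2
    + 4 * (A₁ - A₄ - A₂ + A₃) * hnorm
end
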